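/- arXiv:1807.05777 — 4 statements merged into one kernel-verified Lean document; each statement's English description precedes it below -/
import Mathlib

section
/- For a non-trivial unordered partition up of [1,k] with e classes of even cardinality and o classes of odd cardinality, the set usage⁻¹(up) of failures with usage pattern up is in bijection with the set of injective functions inst : up → V satisfying t = Σ_{S ∈ up, |S| odd} inst(S). -/
/-- The usage pattern of a tuple `v = (v_1,…,v_k)`: the unordered partition of `[1,k]`
induced by the equivalence `i ≡_v j ↔ v_i = v_j`. -/
def usage {d k : ℕ} (v : Fin k → (Fin d → ZMod 2)) : Finset (Finset (Fin k)) :=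
  Finset.image (fun i => Finset.univ.filter (fun j => v j = v i)) Finset.univ

/-- The map sending an index to its class in a partition. -/
theorem exists_surjective_class_map {α : Type*} [Fintype α] [DecidableEq α]
    {P : Finset (Finset α)}
    (hpart : (∀ S ∈ P, S ≠ ∅) ∧ (∀ S ∈ P, ∀ T ∈ P, S ≠ T → Disjoint S T) ∧
      P.biUnion id = Finset.univ) :
    ∃ c : α → {S // S ∈ P}, Function.Surjective c ∧ ∀ i S, i ∈ S.1 ↔ c i = S := by
  obtain ⟨hne, hdisj, hcover⟩ := hpart
  have hex : ∀ i : α, ∃ S : {S // S ∈ P}, i ∈ S.1 := by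
    intro i
    have hi : i ∈ P.biUnion id := hcover ▸ Finset.mem_univ i
    obtain ⟨S, hS, hiS⟩ := Finset.mem_biUnion.1 hi
    exact ⟨⟨S, hS⟩, hiS⟩
  choose c hc using hex
  have hmem : ∀ i S, i ∈ S.1 ↔ c i = S := by
    refine fun i S => ⟨fun hi => ?_, fun h => h ▸ hc i⟩
    by_contra h
    exact Finset.disjoint_left.1
      (hdisj _ (c i).2 _ S.2 fun h' => h (Subtype.ext h')) (hc i) hi
  refine ⟨c, fun S => ?_, hmem⟩
  obtain ⟨i, hi⟩ := Finset.nonempty_iff_ne_empty.2 (hne S.1 S.2)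
  exact ⟨i, (hmem i S).1 hi⟩

theorem usage_eq_iff {d k : ℕ} {P : Finset (Finset (Fin k))} {c : Fin k → {S // S ∈ P}}
    (hsurj : Function.Surjective c) (hmem : ∀ i S, i ∈ S.1 ↔ c i = S)
    (v : Fin k → (Fin d → ZMod 2)) :
    usage v = P ↔ ∀ i j, v i = v j ↔ c i = c j := by
  constructor
  · intro h i j
    have hj : Finset.univ.filter (fun l => v l = v j) ∈ P :=
      h ▸ Finset.mem_image_of_mem _ (Finset.mem_univ j)
    have hcj : c j = ⟨_, hj⟩ := (hmem j ⟨_, hj⟩).1 (by simp)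
    rw [hcj, ← hmem]
    simp
  · intro h
    have hclass : ∀ i, Finset.univ.filter (fun j => v j = v i) = (c i).1 := by
      intro i
      ext j
      simp [h, hmem]
    ext S
    simp only [usage, hclass, Finset.mem_image, Finset.mem_univ, true_and]
    constructor
    · rintro ⟨i, rfl⟩
      exact (c i).2
    · intro hS
      obtain ⟨i, hi⟩ := hsurj ⟨S, hS⟩
      exact ⟨i, by rw [hi]⟩

theorem nsmul_eq_ite_odd {d : ℕ} (n : ℕ) (x : Fin d → ZMod 2) :
    n • x = if Odd n then x else 0 := by
  ext a
  rw [Pi.smul_apply, nsmul_eq_mul]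
  split_ifs with h
  · rw [ZMod.natCast_eq_one_iff_odd.2 h, one_mul]
  · rw [ZMod.natCast_eq_zero_iff_even.2 (Nat.not_odd_iff_even.1 h), zero_mul, Pi.zero_apply]

theorem sum_comp_class_map {d k : ℕ} {P : Finset (Finset (Fin k))}
    {c : Fin k → {S // S ∈ P}} (hmem : ∀ i S, i ∈ S.1 ↔ c i = S)
    (inst : {S // S ∈ P} → (Fin d → ZMod 2)) :
    ∑ i, inst (c i) = ∑ S ∈ P.attach.filter (fun S => Odd S.1.card), inst S := by
  rw [← Finset.sum_fiberwise_of_maps_to (t := P.attach) (g := c)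
    fun i _ => Finset.mem_attach P (c i), Finset.sum_filter]
  refine Finset.sum_congr rfl fun S _ => ?_
  have hfiber : Finset.univ.filter (fun i => c i = S) = S.1 := by
    ext i
    simp [hmem]
  rw [hfiber, Finset.sum_congr rfl fun i hi => by rw [(hmem i S).1 hi],
    Finset.sum_const, nsmul_eq_ite_odd]

/-- For a non-trivial unordered partition `up` of `[1,k]`, the set
`usage⁻¹(up)` of failures with usage pattern `up` is in bijection with the set of
injective functions `inst : up → V` satisfying `t = Σ_{S ∈ up, |S| odd} inst(S)`. -/
theorem usage_fiber_equiv_instantiations (d k : ℕ) (V : Finset (Fin d → ZMod 2))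
    (t : Fin d → ZMod 2) (P : Finset (Finset (Fin k)))
    (hpart : (∀ S ∈ P, S ≠ ∅) ∧ (∀ S ∈ P, ∀ T ∈ P, S ≠ T → Disjoint S T) ∧
      P.biUnion id = Finset.univ)
    (hnontriv : ¬(∀ S ∈ P, S.card = 1)) :
    Nonempty
      ({v : Fin k → (Fin d → ZMod 2) //
          (∀ i, v i ∈ V) ∧ ∑ i, v i = t ∧ (∃ i j, i ≠ j ∧ v i = v j) ∧ usage v = P}
        ≃ {inst : {S // S ∈ P} → (Fin d → ZMod 2) //
            Function.Injective inst ∧ (∀ S, inst S ∈ V) ∧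
              t = ∑ S ∈ P.attach.filter (fun S => Odd S.1.card), inst S}) := by
  obtain ⟨c, hsurj, hmem⟩ := exists_surjective_class_map hpart
  have hrepeat : ∃ i j, i ≠ j ∧ c i = c j := by
    by_contra! h
    refine hnontriv fun S hS => ?_
    obtain ⟨i, hi⟩ := hsurj ⟨S, hS⟩
    refine Finset.card_eq_one.2 ⟨i, Finset.eq_singleton_iff_unique_mem.2
      ⟨(hmem i ⟨S, hS⟩).2 hi, fun j hj => ?_⟩⟩
    by_contra hji
    exact h j i hji (((hmem j ⟨S, hS⟩).1 hj).trans hi.symm)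
  let rep := Function.surjInv hsurj
  have hrep : ∀ S, c (rep S) = S := Function.surjInv_eq hsurj
  have hfactor : ∀ v : Fin k → (Fin d → ZMod 2), usage v = P → ∀ i, v (rep (c i)) = v i :=
    fun v hv i => ((usage_eq_iff hsurj hmem v).1 hv _ _).2 (hrep (c i))
  exact ⟨{
    toFun := fun v => ⟨fun S => v.1 (rep S), by
      obtain ⟨v, hV, hsum, -, hv⟩ := v
      refine ⟨fun S T h => ?_, fun S => hV _, ?_⟩
      · simpa only [hrep] using ((usage_eq_iff hsurj hmem v).1 hv _ _).1 h
      · rw [← sum_comp_class_map hmem]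
        exact hsum.symm.trans <| Finset.sum_congr rfl fun i _ => (hfactor v hv i).symm⟩
    invFun := fun inst => ⟨fun i => inst.1 (c i), by
      obtain ⟨inst, hinj, hV, hsum⟩ := inst
      obtain ⟨i, j, hij, hc⟩ := hrepeat
      exact ⟨fun i => hV _, (sum_comp_class_map hmem inst).trans hsum.symm,
        ⟨i, j, hij, congrArg inst hc⟩,
        (usage_eq_iff hsurj hmem _).2 fun i j => hinj.eq_iff⟩⟩
    left_inv := fun v => Subtype.ext (funext (hfactor v.1 v.2.2.2.2))
    right_inv := fun inst => Subtype.ext (funext fun S => congrArg inst.1 (hrep S)) }⟩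
end

section
/- The number of failures satisfies |Fail(V,t,k)| = Σ_{(e,o) ∈ ℕ×ℕ, e+o < k} |paritycount⁻¹(e,o)| · (m−o)!/(m−o−e)! · |Wit(V,t,o)|, where paritycount⁻¹(e,o) is the set of unordered partitions of [1,k] with exactly e classes of even cardinality and o classes of odd cardinality, and m = |V|. -/
/-- The partition of the index set into the fibres of `v`. -/
def fibrePartition {ι α : Type*} [Fintype ι] [DecidableEq ι] [DecidableEq α] (v : ι → α) :
    Finset (Finset ι) :=
  Finset.univ.image fun i => Finset.univ.filter fun j => v j = v i

/-- `P` is a set partition of the finite type `ι`. -/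
def IsSetPartition {ι : Type*} [Fintype ι] [DecidableEq ι] (P : Finset (Finset ι)) : Prop :=
  (∀ S ∈ P, S ≠ ∅) ∧ (∀ S ∈ P, ∀ T ∈ P, S ≠ T → Disjoint S T) ∧ P.biUnion id = Finset.univ

theorem isSetPartition_fibrePartition {ι α : Type*} [Fintype ι] [DecidableEq ι] [DecidableEq α]
    (v : ι → α) : IsSetPartition (fibrePartition v) := by
  refine ⟨?_, ?_, ?_⟩
  · simp only [fibrePartition, Finset.mem_image, Finset.mem_univ, true_and]
    rintro _ ⟨i, rfl⟩
    exact Finset.ne_empty_of_mem (a := i) (by simp)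
  · simp only [fibrePartition, Finset.mem_image, Finset.mem_univ, true_and]
    rintro _ ⟨i, rfl⟩ _ ⟨j, rfl⟩ hij
    rw [Finset.disjoint_left]
    intro a ha hb
    simp only [Finset.mem_filter, Finset.mem_univ, true_and] at ha hb
    exact hij (by rw [← ha, ← hb])
  · ext i
    simp only [fibrePartition, Finset.mem_biUnion, Finset.mem_image, Finset.mem_univ, true_and,
      id, iff_true]
    exact ⟨_, ⟨i, rfl⟩, by simp⟩

theorem IsSetPartition.exists_classMap {ι : Type*} [Fintype ι] [DecidableEq ι]
    {P : Finset (Finset ι)} (hP : IsSetPartition P) :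
    ∃ c : ι → P, Function.Surjective c ∧ ∀ i S, c i = S ↔ i ∈ S.1 := by
  obtain ⟨hne, hdisj, hcov⟩ := hP
  have hex : ∀ i, ∃ S : P, i ∈ S.1 := by
    intro i
    have hi : i ∈ P.biUnion id := hcov ▸ Finset.mem_univ i
    obtain ⟨S, hS, hiS⟩ := Finset.mem_biUnion.1 hi
    exact ⟨⟨S, hS⟩, hiS⟩
  choose c hc using hex
  have hiff : ∀ i S, c i = S ↔ i ∈ S.1 := by
    intro i S
    refine ⟨fun h => h ▸ hc i, fun h => ?_⟩
    by_contra hcS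
    exact Finset.disjoint_left.1
      (hdisj _ (c i).2 _ S.2 fun h' => hcS (Subtype.ext h')) (hc i) h
  refine ⟨c, fun S => ?_, hiff⟩
  obtain ⟨i, hi⟩ := Finset.nonempty_iff_ne_empty.2 (hne _ S.2)
  exact ⟨i, (hiff i S).2 hi⟩

theorem fibrePartition_eq_iff {ι α : Type*} [Fintype ι] [DecidableEq ι] [DecidableEq α]
    {P : Finset (Finset ι)} {c : ι → P} (hsurj : Function.Surjective c)
    (hc : ∀ i S, c i = S ↔ i ∈ S.1) (v : ι → α) :
    fibrePartition v = P ↔ ∀ i j, v i = v j ↔ c i = c j := by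
  constructor
  · intro h i j
    have hmem : (Finset.univ.filter fun l => v l = v j) ∈ P :=
      h ▸ Finset.mem_image_of_mem _ (Finset.mem_univ j)
    have hcj : c j = ⟨_, hmem⟩ := (hc _ _).2 (by simp)
    rw [hcj, hc]
    simp
  · intro h
    have hfib : ∀ i, (Finset.univ.filter fun j => v j = v i) = (c i).1 := by
      intro i
      ext j
      simp [h, hc]
    ext S
    simp only [fibrePartition, hfib, Finset.mem_image, Finset.mem_univ, true_and]
    constructor
    · rintro ⟨i, rfl⟩
      exact (c i).2
    · intro hS
      obtain ⟨i, hi⟩ := hsurj ⟨S, hS⟩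
      exact ⟨i, by rw [hi]⟩

/-- Functions into `V` with the same fibres as the surjection `c` are embeddings of its codomain. -/
noncomputable def equivEmbeddingOfSurjective {ι β α : Type*} (V : Finset α) (c : ι → β)
    (hc : Function.Surjective c) :
    {v : ι → α // (∀ i, v i ∈ V) ∧ ∀ i j, v i = v j ↔ c i = c j} ≃ (β ↪ V) where
  toFun v := ⟨fun b => ⟨v.1 (Function.surjInv hc b), v.2.1 _⟩, fun a b h => by
    simpa [v.2.2, Function.surjInv_eq] using h⟩
  invFun g := ⟨fun i => g (c i), fun i => (g (c i)).2, fun i j => by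
    simp only [SetLike.coe_eq_coe, EmbeddingLike.apply_eq_iff_eq]⟩
  left_inv v := by
    ext i
    exact (v.2.2 _ _).2 (Function.surjInv_eq hc _)
  right_inv g := by
    ext b
    simp [Function.surjInv_eq]

theorem card_eq_card_embedding_of_surjective {ι β α : Type*} [Fintype ι] [AddCommMonoid α]
    (V : Finset α) (t : α) (c : ι → β) (hc : Function.Surjective c) :
    Nat.card {v : ι → α // (∀ i, v i ∈ V) ∧ ∑ i, v i = t ∧ ∀ i j, v i = v j ↔ c i = c j} =
      Nat.card {g : β ↪ V // ∑ i, (g (c i) : α) = t} := by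
  refine Nat.card_congr ?_
  calc {v : ι → α // (∀ i, v i ∈ V) ∧ ∑ i, v i = t ∧ ∀ i j, v i = v j ↔ c i = c j}
      ≃ {v : ι → α // ((∀ i, v i ∈ V) ∧ ∀ i j, v i = v j ↔ c i = c j) ∧ ∑ i, v i = t} :=
        Equiv.subtypeEquivRight fun v => by tauto
    _ ≃ {v : {v : ι → α // (∀ i, v i ∈ V) ∧ ∀ i j, v i = v j ↔ c i = c j} //
          ∑ i, v.1 i = t} := (Equiv.subtypeSubtypeEquivSubtypeInter _ _).symm
    _ ≃ {g : β ↪ V // ∑ i, (g (c i) : α) = t} :=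
        ((equivEmbeddingOfSurjective V c hc).symm.subtypeEquiv fun g => Iff.rfl).symm

theorem card_sum_embedding {A B α : Type*} [Fintype A] [Fintype B] [AddCommMonoid α]
    (V : Finset α) (t : α) :
    Nat.card {f : A ⊕ B ↪ V // ∑ a, (f (Sum.inl a) : α) = t} =
      (V.card - Fintype.card A).descFactorial (Fintype.card B) *
        Nat.card {w : A ↪ V // ∑ a, (w a : α) = t} := by
  classical
  have e : {f : A ⊕ B ↪ V // ∑ a, (f (Sum.inl a) : α) = t} ≃
      Σ w : {w : A ↪ V // ∑ a, (w a : α) = t}, B ↪ ↥(Set.range w.1)ᶜ :=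
    (Equiv.sumEmbeddingEquivSigmaEmbeddingRestricted.subtypeEquiv fun f => Iff.rfl).trans
      (Equiv.subtypeSigmaEquiv (fun w : A ↪ V => B ↪ ↥(Set.range w)ᶜ)
        fun w => ∑ a, (w a : α) = t)
  rw [Nat.card_congr e, Nat.card_sigma]
  have hfib : ∀ w : {w : A ↪ V // ∑ a, (w a : α) = t}, Nat.card (B ↪ ↥(Set.range w.1)ᶜ) =
      (V.card - Fintype.card A).descFactorial (Fintype.card B) := by
    intro w
    rw [Nat.card_eq_fintype_card, Fintype.card_embedding_eq, Fintype.card_compl_set,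
      Set.card_range_of_injective w.1.injective, Fintype.card_coe]
  rw [Finset.sum_congr rfl fun w _ => hfib w, Finset.sum_const, Finset.card_univ,
    smul_eq_mul, mul_comm, Nat.card_eq_fintype_card]

theorem card_embedding_of_equiv {A B α : Type*} [Fintype A] [Fintype B] [AddCommMonoid α]
    (V : Finset α) (t : α) (e : A ≃ B) :
    Nat.card {w : A ↪ V // ∑ a, (w a : α) = t} = Nat.card {w : B ↪ V // ∑ b, (w b : α) = t} := by
  refine Nat.card_congr ((Equiv.embeddingCongr e (Equiv.refl _)).subtypeEquiv fun w => ?_)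
  rw [← e.sum_comp]
  simp

theorem card_embedding_eq_card_witnesses {ι α : Type*} [Fintype ι] [AddCommMonoid α]
    (V : Finset α) (t : α) :
    Nat.card {w : ι ↪ V // ∑ a, (w a : α) = t} =
      Nat.card {w : ι → α // (∀ i, w i ∈ V) ∧ ∑ i, w i = t ∧ ∀ i j, i ≠ j → w i ≠ w j} := by
  refine (card_eq_card_embedding_of_surjective V t (id : ι → ι) Function.surjective_id).symm.trans ?_
  refine Nat.card_congr (Equiv.subtypeEquivRight fun v => ?_)
  refine and_congr_right fun _ => and_congr_right fun _ => ?_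
  exact ⟨fun h i j hij hv => hij ((h i j).1 hv),
    fun h i j => ⟨fun hv => by_contra fun hij => h i j hij hv, fun hij => congrArg v hij⟩⟩

theorem card_subtype_coe {α : Type*} (P : Finset α) (p : α → Prop) [DecidablePred p] :
    Fintype.card {a : P // p a} = (P.filter p).card := by
  classical
  rw [← Fintype.card_coe]
  exact Fintype.card_congr ((Equiv.subtypeSubtypeEquivSubtypeInter (· ∈ P) p).trans
    (Equiv.subtypeEquivRight fun a => by simp))

theorem card_same_fibres {ι α : Type*} [Fintype ι] [DecidableEq ι] [DecidableEq α]
    [AddCommMonoid α] (hα : ∀ a : α, 2 • a = 0) (V : Finset α) (t : α)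
    {P : Finset (Finset ι)} (hP : IsSetPartition P) :
    Nat.card {v : ι → α // (∀ i, v i ∈ V) ∧ ∑ i, v i = t ∧ fibrePartition v = P} =
      (V.card - (P.filter fun S => Odd S.card).card).descFactorial
          (P.filter fun S => Even S.card).card *
        Nat.card {w : Fin (P.filter fun S => Odd S.card).card → α //
          (∀ i, w i ∈ V) ∧ ∑ i, w i = t ∧ ∀ i j, i ≠ j → w i ≠ w j} := by
  obtain ⟨c, hsurj, hc⟩ := hP.exists_classMap
  have hodd : Fintype.card {S : P // Odd S.1.card} = (P.filter fun S => Odd S.card).card :=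
    card_subtype_coe P fun S => Odd S.card
  have heven : Fintype.card {S : P // ¬ Odd S.1.card} =
      (P.filter fun S => Even S.card).card := by
    simp only [Nat.not_odd_iff_even]
    exact card_subtype_coe P fun S => Even S.card
  have hsum : ∀ g : P → α, ∑ i, g (c i) = ∑ S : {S : P // Odd S.1.card}, g S := by
    intro g
    have hfib : ∀ S : P, (Finset.univ.filter fun i => c i = S) = S.1 := fun S => by
      ext i; simp [hc]
    rw [← Finset.sum_fiberwise_of_maps_to (g := c) (t := Finset.univ) (by simp)]
    have hterm : ∀ S : P, ∑ i ∈ Finset.univ.filter (fun i => c i = S), g (c i) =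
        if Odd S.1.card then g S else 0 := by
      intro S
      rw [Finset.sum_congr rfl (g := fun _ => g S) (by simp +contextual), Finset.sum_const, hfib]
      split_ifs with h
      · obtain ⟨n, hn⟩ := h
        rw [hn, add_smul, mul_comm, mul_smul, hα, smul_zero, zero_add, one_smul]
      · obtain ⟨n, hn⟩ := Nat.not_odd_iff_even.1 h
        rw [hn, ← two_mul, mul_comm, mul_smul, hα, smul_zero]
    rw [Finset.sum_congr rfl fun S _ => hterm S, ← Finset.sum_filter]
    exact Finset.sum_subtype _ (by simp) _
  rw [← card_embedding_eq_card_witnesses, ← hodd, ← heven,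
    card_embedding_of_equiv V t (Fintype.equivFin _).symm, ← card_sum_embedding]
  simp only [fibrePartition_eq_iff hsurj hc]
  rw [card_eq_card_embedding_of_surjective V t c hsurj]
  refine Nat.card_congr ((Equiv.embeddingCongr (Equiv.sumCompl fun S : P => Odd S.1.card).symm
    (Equiv.refl _)).subtypeEquiv fun g => ?_)
  rw [hsum fun S => (g S : α)]
  simp

theorem card_even_add_card_odd {ι : Type*} (P : Finset (Finset ι)) :
    (P.filter fun S => Even S.card).card + (P.filter fun S => Odd S.card).card = P.card := by
  simp only [← Nat.not_even_iff_odd]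
  exact Finset.card_filter_add_card_filter_not _

theorem exists_ne_iff_card_fibrePartition_lt {ι α : Type*} [Fintype ι] [DecidableEq ι]
    [DecidableEq α] (v : ι → α) :
    (∃ i j, i ≠ j ∧ v i = v j) ↔ (fibrePartition v).card < Fintype.card ι := by
  have himage : (fibrePartition v).card = (Finset.univ.image v).card := by
    refine (Finset.card_bij (fun a _ => Finset.univ.filter fun j => v j = a) ?_ ?_ ?_).symm
    · simp only [fibrePartition, Finset.mem_image, Finset.mem_univ, true_and]
      rintro _ ⟨i, rfl⟩
      exact ⟨i, rfl⟩
    · simp only [Finset.mem_image, Finset.mem_univ, true_and]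
      rintro _ ⟨i, rfl⟩ b - h
      simpa using Finset.ext_iff.1 h i
    · simp only [fibrePartition, Finset.mem_image, Finset.mem_univ, true_and]
      rintro _ ⟨i, rfl⟩
      exact ⟨_, ⟨i, rfl⟩, rfl⟩
  rw [himage, ← Finset.card_univ, lt_iff_le_and_ne, ne_eq, Finset.card_image_iff,
    Finset.coe_univ, Set.injOn_univ]
  simp only [Finset.card_image_le, true_and, Function.not_injective_iff]
  exact exists₂_congr fun _ _ => and_comm

/-- The number of failures satisfies
`|Fail(V,t,k)| = Σ_{(e,o) ∈ ℕ×ℕ, e+o < k} |paritycount⁻¹(e,o)| · (m−o)!/(m−o−e)! · |Wit(V,t,o)|`,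
where `paritycount⁻¹(e,o)` is the set of unordered partitions of `[1,k]` with exactly `e`
classes of even cardinality and `o` classes of odd cardinality, `m = |V|`, and
`(m−o)!/(m−o−e)!` is the falling factorial `(m−o)(m−o−1)⋯(m−o−e+1)` (which is `0` when
`e > m − o`), here written `Nat.descFactorial (m−o) e`. -/
theorem card_failures_eq_sum (d k : ℕ) (V : Finset (Fin d → ZMod 2))
    (t : Fin d → ZMod 2) :
    Nat.card {v : Fin k → (Fin d → ZMod 2) //
        (∀ i, v i ∈ V) ∧ ∑ i, v i = t ∧ ∃ i j, i ≠ j ∧ v i = v j}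
      = ∑ p ∈ (Finset.range k ×ˢ Finset.range k).filter (fun p => p.1 + p.2 < k),
          (Finset.univ.filter (fun P : Finset (Finset (Fin k)) =>
              ((∀ S ∈ P, S ≠ ∅) ∧ (∀ S ∈ P, ∀ T ∈ P, S ≠ T → Disjoint S T) ∧
                  P.biUnion id = Finset.univ) ∧
                (P.filter (fun S => Even S.card)).card = p.1 ∧
                (P.filter (fun S => Odd S.card)).card = p.2)).card
            * Nat.descFactorial (V.card - p.2) p.1
            * Nat.card {w : Fin p.2 → (Fin d → ZMod 2) //
                (∀ i, w i ∈ V) ∧ ∑ i, w i = t ∧ ∀ i j, i ≠ j → w i ≠ w j} := by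
  classical
  have hα : ∀ a : Fin d → ZMod 2, 2 • a = 0 := fun a => by
    ext i
    exact CharTwo.two_nsmul (a i)
  set pc : Finset (Finset (Fin k)) → ℕ × ℕ := fun P =>
    ((P.filter fun S => Even S.card).card, (P.filter fun S => Odd S.card).card) with hpc
  set I := (Finset.range k ×ˢ Finset.range k).filter (fun p => p.1 + p.2 < k) with hI
  have hmemI : ∀ P : Finset (Finset (Fin k)), pc P ∈ I ↔ P.card < k := by
    intro P
    have h := card_even_add_card_odd P
    simp only [hI, hpc, Finset.mem_filter, Finset.mem_product, Finset.mem_range]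
    omega
  have hfilter : ∀ p : ℕ × ℕ, (Finset.univ.filter (fun P : Finset (Finset (Fin k)) =>
        ((∀ S ∈ P, S ≠ ∅) ∧ (∀ S ∈ P, ∀ T ∈ P, S ≠ T → Disjoint S T) ∧
            P.biUnion id = Finset.univ) ∧
          (P.filter (fun S => Even S.card)).card = p.1 ∧
          (P.filter (fun S => Odd S.card)).card = p.2)) =
      Finset.univ.filter fun P => IsSetPartition P ∧ pc P = p := fun p => by
    ext P
    simp [IsSetPartition, hpc, Prod.ext_iff]
  rw [Nat.card_eq_fintype_card, Fintype.card_subtype,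
    Finset.card_eq_sum_card_fiberwise (f := fun v => pc (fibrePartition v)) (t := I)]
  · refine Finset.sum_congr rfl fun p hp => ?_
    rw [hfilter, mul_assoc, ← smul_eq_mul,
      Finset.card_eq_sum_card_fiberwise (f := fibrePartition)
        (t := Finset.univ.filter fun P => IsSetPartition P ∧ pc P = p)]
    · refine Finset.sum_eq_card_nsmul fun P hP => ?_
      simp only [Finset.mem_filter, Finset.mem_univ, true_and] at hP
      obtain ⟨hP, rfl⟩ := hP
      rw [← card_same_fibres hα V t hP, Nat.card_eq_fintype_card, Fintype.card_subtype]
      congr 1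
      ext v
      simp only [Finset.mem_filter, Finset.mem_univ, true_and,
        exists_ne_iff_card_fibrePartition_lt, Fintype.card_fin]
      constructor
      · rintro ⟨⟨⟨hV, ht, -⟩, -⟩, h⟩
        exact ⟨hV, ht, h⟩
      · rintro ⟨hV, ht, h⟩
        exact ⟨⟨⟨hV, ht, h ▸ (hmemI P).1 hp⟩, by rw [h]⟩, h⟩
    · intro v hv
      simp only [Finset.coe_filter, Finset.mem_filter, Finset.mem_univ, true_and,
        Set.mem_ofPred_eq] at hv ⊢
      exact ⟨isSetPartition_fibrePartition v, hv.2⟩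
  · intro v hv
    simp only [Finset.coe_filter, Finset.mem_univ, true_and, Set.mem_ofPred_eq,
      exists_ne_iff_card_fibrePartition_lt, Fintype.card_fin] at hv
    exact (hmemI _).2 hv.2.2
end

section
/- Given an ℓ-uniform hypergraph G = (U, E) with ℓ dividing |U|, set d = |U|, V = { λ(e) : e ∈ E } ⊆ F_2^d, t = (1,…,1), and k = d/ℓ. Then the number of perfect matchings of G satisfies |Wit(V,t,k)| = k! · |Perfect(G)|, since each perfect matching yields k! witnesses. -/
open Finset in
/-- If a `k`-tuple of sets of size `ℓ` is such that every point lies in some member and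
`ℓ * k` is the number of points, then every point lies in exactly one member. -/
theorem card_filter_mem_eq_one_of_cover {U ι : Type*} [Fintype U] [DecidableEq U] [Fintype ι]
    {f : ι → Finset U} {ℓ : ℕ} (hf : ∀ i, (f i).card = ℓ)
    (hcard : ℓ * Fintype.card ι = Fintype.card U) (hcover : ∀ u, ∃ i, u ∈ f i) (u : U) :
    #{i | u ∈ f i} = 1 := by
  have hsum : ∑ u : U, #{i | u ∈ f i} = ∑ _u : U, 1 := by
    have := sum_card_bipartiteAbove_eq_sum_card_bipartiteBelow (s := (univ : Finset U))
      (t := (univ : Finset ι)) (fun u i => u ∈ f i)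
    simp only [bipartiteAbove, bipartiteBelow, filter_univ_mem, hf] at this
    rw [this]
    simp [← hcard, mul_comm]
  have hle : ∀ u ∈ (univ : Finset U), 1 ≤ #{i | u ∈ f i} := fun u _ => by
    obtain ⟨i, hi⟩ := hcover u
    exact card_pos.2 ⟨i, by simpa using hi⟩
  exact ((sum_eq_sum_iff_of_le hle).1 hsum.symm u (mem_univ u)).symm

/-- The indicator vectors over `ZMod 2` of a tuple of distinct `ℓ`-sets sum to the all-ones vector
if and only if these sets partition the `ℓ * k` points. -/
theorem sum_indicator_eq_one_iff {U ι : Type*} [Fintype U] [DecidableEq U] [Fintype ι]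
    (f : ι ↪ Finset U) {ℓ : ℕ} (hf : ∀ i, (f i).card = ℓ)
    (hcard : ℓ * Fintype.card ι = Fintype.card U) :
    (∑ i, fun u => if u ∈ f i then (1 : ZMod 2) else 0) = (fun _ => 1) ↔
      (∀ e₁ ∈ Finset.univ.map f, ∀ e₂ ∈ Finset.univ.map f, e₁ ≠ e₂ → Disjoint e₁ e₂) ∧
        (Finset.univ.map f).biUnion id = Finset.univ := by
  have hsum : (∑ i, fun u => if u ∈ f i then (1 : ZMod 2) else 0) = (fun _ => 1) ↔
      ∀ u, (((Finset.univ.filter fun i => u ∈ f i).card : ℕ) : ZMod 2) = 1 := by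
    simp [funext_iff, Finset.sum_apply]
  rw [hsum]
  constructor
  · intro h
    have hcover : ∀ u, ∃ i, u ∈ f i := fun u => by
      by_contra! hu
      simpa [hu] using h u
    refine ⟨?_, by ext u; simpa using hcover u⟩
    simp only [Finset.mem_map, Finset.mem_univ, true_and, forall_exists_index,
      forall_apply_eq_imp_iff]
    intro i j hij
    refine Finset.disjoint_left.2 fun u hi hj => hij ?_
    have h1 := card_filter_mem_eq_one_of_cover hf hcard hcover u
    rw [Finset.card_le_one.1 h1.le i (by simpa using hi) j (by simpa using hj)]
  · rintro ⟨-, hU⟩ u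
    have hcover : ∀ u, ∃ i, u ∈ f i := fun u => by
      simpa using hU.ge (Finset.mem_univ u)
    simp [card_filter_mem_eq_one_of_cover hf hcard hcover u]

/-- Embeddings of `Fin k` with range a given `k`-element set are the embeddings into that set. -/
def embeddingMapEqEquiv {α : Type*} {k : ℕ} (P : Finset α) (hP : P.card = k) :
    {f : Fin k ↪ α // Finset.univ.map f = P} ≃ (Fin k ↪ P) where
  toFun f := ⟨fun i => ⟨f.1 i, f.2.le (Finset.mem_map_of_mem f.1 (Finset.mem_univ i))⟩,
    fun _ _ h => f.1.injective (congrArg Subtype.val h)⟩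
  invFun g := ⟨g.trans (Function.Embedding.subtype _), Finset.eq_of_subset_of_card_le
    (fun x hx => by
      obtain ⟨i, -, rfl⟩ := Finset.mem_map.1 hx
      exact (g i).2) (by simp [hP])⟩
  left_inv _ := rfl
  right_inv _ := rfl

/-- Each `k`-element set is enumerated by exactly `k!` injective `k`-tuples. -/
theorem card_embedding_map_univ {α : Type*} [Finite α] {k : ℕ} (p : Finset α → Prop)
    (hp : ∀ P, p P → P.card = k) :
    Nat.card {f : Fin k ↪ α // p (Finset.univ.map f)} =
      k.factorial * Nat.card {P : Finset α // p P} := by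
  classical
  have := Fintype.ofFinite α
  rw [← Nat.card_congr (Equiv.sigmaSubtypeFiberEquivSubtype
    (fun f : Fin k ↪ α => Finset.univ.map f) (p := fun f => p (Finset.univ.map f)) (q := p)
    fun _ => Iff.rfl), Nat.card_sigma]
  have hfiber (P : {P : Finset α // p P}) :
      Nat.card {f : Fin k ↪ α // Finset.univ.map f = P} = k.factorial := by
    rw [Nat.card_congr (embeddingMapEqEquiv P.1 (hp _ P.2)), Nat.card_eq_fintype_card,
      Fintype.card_embedding_eq]
    simp [hp _ P.2, Nat.descFactorial_self]
  simp only [hfiber]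
  simp [mul_comm]

theorem indicator_zmod_two_injective {U : Type*} [DecidableEq U] :
    Function.Injective fun (e : Finset U) (u : U) => if u ∈ e then (1 : ZMod 2) else 0 := by
  intro e₁ e₂ h
  ext u
  have := congrFun h u
  by_cases h₁ : u ∈ e₁ <;> by_cases h₂ : u ∈ e₂ <;> simp_all


/-- Reduction from perfect matching: given an `ℓ`-uniform hypergraph
`G = (U, E)` with `ℓ · k = |U|` (i.e. `ℓ` divides `|U|` and `k = |U|/ℓ`), set `d = |U|`,
`V = {λ(e) : e ∈ E} ⊆ F_2^U` (indicator vectors), `t = (1,…,1)`. Then each perfect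
matching corresponds to exactly `k!` witnesses: `|Wit(V,t,k)| = k! · |Perfect(G)|`. -/
theorem card_witnesses_eq_factorial_mul_card_perfectMatchings
    (U : Type*) [Fintype U] [DecidableEq U] (E : Finset (Finset U)) (ℓ k : ℕ)
    (hℓ : 1 ≤ ℓ) (huniform : ∀ e ∈ E, e.card = ℓ) (hk : ℓ * k = Fintype.card U) :
    Nat.card {v : Fin k → (U → ZMod 2) //
        (∀ i, v i ∈ E.image (fun e => fun u => if u ∈ e then (1 : ZMod 2) else 0)) ∧
          ∑ i, v i = (fun _ => (1 : ZMod 2)) ∧ ∀ i j, i ≠ j → v i ≠ v j}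
      = k.factorial
        * Nat.card {P : Finset (Finset U) //
            P ⊆ E ∧ (∀ e₁ ∈ P, ∀ e₂ ∈ P, e₁ ≠ e₂ → Disjoint e₁ e₂) ∧
              P.biUnion id = Finset.univ} := by
  rw [← card_embedding_map_univ]
  · symm
    refine Nat.card_eq_of_bijective (fun f => ⟨fun i u => if u ∈ f.1 i then 1 else 0, ?_⟩) ⟨?_, ?_⟩
    · obtain ⟨f, hfE, hf⟩ := f
      have hmem : ∀ i, f i ∈ E := fun i => hfE (Finset.mem_map_of_mem f (Finset.mem_univ i))
      exact ⟨fun i => Finset.mem_image_of_mem _ (hmem i),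
        (sum_indicator_eq_one_iff f (fun i => huniform _ (hmem i)) (by simpa using hk)).2 hf,
        fun i j hij h => hij (f.injective (indicator_zmod_two_injective h))⟩
    · intro f g h
      ext1
      ext1 i
      exact indicator_zmod_two_injective (congrFun (congrArg Subtype.val h) i)
    · rintro ⟨v, hvE, hsum, hv⟩
      simp only [Finset.mem_image] at hvE
      choose e heE hev using hvE
      obtain rfl := funext hev
      let f : Fin k ↪ Finset U := ⟨e, fun i j h => by
        by_contra hij
        exact hv i j hij (by simp only [h])⟩
      refine ⟨⟨f, fun x hx => ?_, (sum_indicator_eq_one_iff f (fun i => huniform _ (heE i))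
        (by simpa using hk)).1 hsum⟩, rfl⟩
      obtain ⟨i, -, rfl⟩ := Finset.mem_map.1 hx
      exact heE i
  · rintro P ⟨hPE, hdisj, hU⟩
    have h := Finset.card_biUnion (s := P) (t := id) hdisj
    rw [hU, Finset.card_univ, ← hk, Finset.sum_congr rfl fun e he => (huniform e (hPE he) : (id e).card = ℓ),
      Finset.sum_const, smul_eq_mul, mul_comm] at h
    exact (Nat.eq_of_mul_eq_mul_right hℓ h).symm
end

section
/- Conversely, if (v_1, …, v_k) is a witness for the instance (V, t, k) constructed from an ℓ-uniform hypergraph G = (U,E) (with V = {λ(e) : e ∈ E}, t the all-ones vector, and k = |U|/ℓ), then P = { λ⁻¹(v_1), …, λ⁻¹(v_k) } is a perfect matching of G: its k edges are pairwise disjoint and cover U. -/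
/-- A finite family of finsets covering a type whose cardinality is the sum of the cardinalities
of the members is pairwise disjoint. -/
theorem pairwise_disjoint_of_cover_of_sum_card_eq {ι U : Type*} [Fintype ι] [Fintype U]
    [DecidableEq U] (S : ι → Finset U) (hcover : ∀ u, ∃ i, u ∈ S i)
    (hcard : ∑ i, (S i).card = Fintype.card U) : Pairwise fun i j => Disjoint (S i) (S j) := by
  have hdouble : ∑ i, (S i).card
      = ∑ u, (Finset.univ.filter fun i => u ∈ S i).card := by
    simpa [Finset.bipartiteAbove, Finset.bipartiteBelow] using
      Finset.sum_card_bipartiteAbove_eq_sum_card_bipartiteBelow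
        (s := Finset.univ) (t := Finset.univ) (fun i u => u ∈ S i)
  have hpos : ∀ u ∈ Finset.univ, 1 ≤ (Finset.univ.filter fun i => u ∈ S i).card := by
    intro u _
    obtain ⟨i, hi⟩ := hcover u
    exact Finset.card_pos.mpr ⟨i, by simpa using hi⟩
  have hone := (Finset.sum_eq_sum_iff_of_le hpos).mp
    (by rw [← hdouble, hcard, Finset.sum_const, smul_eq_mul, mul_one, Finset.card_univ])
  intro i j hij
  rw [Finset.disjoint_left]
  intro u hi hj
  exact hij (Finset.card_le_one.mp (hone u (Finset.mem_univ u)).ge i (by simpa using hi)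
    j (by simpa using hj))

/-- If `(v_1, …, v_k)` is a witness for the instance `(V, t, k)`
constructed from an `ℓ`-uniform hypergraph `G = (U,E)` (with `V = {λ(e) : e ∈ E}`, `t`
the all-ones vector, and `ℓ · k = |U|`), then `P = {λ⁻¹(v_1), …, λ⁻¹(v_k)}` is a perfect
matching of `G`: its `k` edges belong to `E`, are pairwise disjoint, and cover `U`.
Here `λ⁻¹(v_i) = {u ∈ U : v_i(u) = 1}`. -/
theorem witness_yields_perfectMatching
    (U : Type*) [Fintype U] [DecidableEq U] (E : Finset (Finset U)) (ℓ k : ℕ)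
    (hℓ : 1 ≤ ℓ) (huniform : ∀ e ∈ E, e.card = ℓ) (hk : ℓ * k = Fintype.card U)
    (v : Fin k → (U → ZMod 2))
    (hV : ∀ i, v i ∈ E.image (fun e => fun u => if u ∈ e then (1 : ZMod 2) else 0))
    (hsum : ∑ i, v i = (fun _ => (1 : ZMod 2)))
    (hdist : ∀ i j, i ≠ j → v i ≠ v j) :
    (∀ i, Finset.univ.filter (fun u => v i u = 1) ∈ E)
      ∧ (∀ i j, i ≠ j →
          Disjoint (Finset.univ.filter (fun u => v i u = 1))
            (Finset.univ.filter (fun u => v j u = 1)))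
      ∧ Finset.univ.biUnion (fun i => Finset.univ.filter (fun u => v i u = 1))
          = Finset.univ
      ∧ (Finset.univ.image (fun i => Finset.univ.filter (fun u => v i u = 1))).card
          = k := by
  set S : Fin k → Finset U := fun i => Finset.univ.filter (fun u => v i u = 1) with hS
  have hmem : ∀ i, S i ∈ E := by
    intro i
    obtain ⟨e, he, hve⟩ := Finset.mem_image.mp (hV i)
    have hSe : S i = e := by
      ext u
      simp [hS, ← hve]
    exact hSe ▸ he
  have hcover : ∀ u, ∃ i, u ∈ S i := by
    intro u
    have hu : ∑ i, v i u = 1 := by simpa using congrFun hsum u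
    obtain ⟨i, -, hi⟩ := Finset.exists_ne_zero_of_sum_ne_zero (hu ▸ one_ne_zero)
    exact ⟨i, Finset.mem_filter.mpr ⟨Finset.mem_univ u, Fin.eq_one_of_ne_zero (v i u) hi⟩⟩
  have hdisj := pairwise_disjoint_of_cover_of_sum_card_eq S hcover (by
    simp [fun i => huniform _ (hmem i), ← hk, mul_comm])
  refine ⟨hmem, fun i j hij => hdisj hij, ?_, ?_⟩
  · ext u
    simpa using hcover u
  · have hinj : Function.Injective S := by
      intro i j hij
      by_contra hne
      have hempty : S i = ∅ := by simpa [← hij] using hdisj hne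
      have hcard := huniform _ (hmem i)
      rw [hempty, Finset.card_empty] at hcard
      omega
    rw [Finset.card_image_of_injective _ hinj, Finset.card_univ, Fintype.card_fin]
end
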